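/- arXiv:2604.22315 — 5 statements merged into one kernel-verified Lean document; each statement's English description precedes it below -/
import Mathlib

section
/- Let G be a connected finite simple graph, let i be a vertex of G, and let k ≥ 2 be a natural number. Define the k-hop neighborhood N_i^k := { j | 2 ≤ d(i,j) ≤ k }, where d denotes graph distance. Then for every j ∈ N_i^k there exists a vertex q ∈ N_i^k such that: (a) q lies in the same connected component as j of the subgraph of G induced on the vertex set N_i^k (i.e., j and q are joined by a walk all of whose vertices belong to N_i^k), and (b) there exists a vertex l adjacent in G to both i and q. In other words, every connected component of the induced subgraph on N_i^k contains a vertex having a common neighbor with i. -/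
/-- In a connected graph, a vertex at distance `n + 1` from `i` has a neighbor at distance `n`. -/
lemma SimpleGraph.Connected.exists_adj_dist_eq {V : Type*} {G : SimpleGraph V}
    (hG : G.Connected) {i j : V} {n : ℕ} (h : G.dist i j = n + 1) :
    ∃ p, G.Adj j p ∧ G.dist i p = n := by
  obtain ⟨w, hw⟩ := hG.exists_walk_length_eq_dist j i
  rw [G.dist_comm, h] at hw
  cases w with
  | nil => simp at hw
  | @cons _ p _ hjp w =>
    refine ⟨p, hjp, le_antisymm ?_ ?_⟩
    · rw [G.dist_comm]
      exact (SimpleGraph.dist_le w).trans (by simpa using hw.le)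
    · have htri := hG.dist_triangle (u := i) (v := p) (w := j)
      rw [SimpleGraph.dist_eq_one_iff_adj.mpr hjp.symm, h] at htri
      omega

/-- Lemma 3(ii): in a connected finite simple graph, every connected component
of the subgraph induced on the `k`-hop neighborhood
`N_i^k = {v | 2 ≤ d(i,v) ≤ k}` of a vertex `i` (with `k ≥ 2`) contains a
vertex `q` having a common neighbor with `i`: for every `j ∈ N_i^k` there is
`q ∈ N_i^k` reachable from `j` inside the induced subgraph, together with a
vertex `l` adjacent in `G` to both `i` and `q`. -/
theorem khop_component_common_neighbor {V : Type*} [Fintype V] (G : SimpleGraph V)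
    (hG : G.Connected) (i : V) (k : ℕ) (hk : 2 ≤ k) :
    ∀ (j : V) (hj : j ∈ {v : V | 2 ≤ G.dist i v ∧ G.dist i v ≤ k}),
      ∃ (q : V) (hq : q ∈ {v : V | 2 ≤ G.dist i v ∧ G.dist i v ≤ k}),
        (G.induce {v : V | 2 ≤ G.dist i v ∧ G.dist i v ≤ k}).Reachable ⟨j, hj⟩ ⟨q, hq⟩ ∧
        ∃ l : V, G.Adj i l ∧ G.Adj q l := by
  intro j hj
  obtain ⟨n, hn⟩ : ∃ n, G.dist i j = n + 2 := ⟨G.dist i j - 2, (Nat.sub_add_cancel hj.1).symm⟩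
  induction n generalizing j with
  | zero =>
    obtain ⟨l, hjl, hl⟩ := hG.exists_adj_dist_eq hn
    exact ⟨j, hj, .refl _, l, SimpleGraph.dist_eq_one_iff_adj.mp hl, hjl⟩
  | succ n ih =>
    obtain ⟨p, hjp, hp⟩ := hG.exists_adj_dist_eq hn
    have hpk : 2 ≤ G.dist i p ∧ G.dist i p ≤ k := ⟨by omega, by have := hj.2; omega⟩
    obtain ⟨q, hq, hpq, hl⟩ := ih p hpk (by omega)
    have hadj : (G.induce {v : V | 2 ≤ G.dist i v ∧ G.dist i v ≤ k}).Adj ⟨j, hj⟩ ⟨p, hpk⟩ := hjp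
    exact ⟨q, hq, hadj.reachable.trans hpq, hl⟩
end

section
/- Let G be a finite simple graph on a finite vertex type V, let L be its graph Laplacian matrix (degree matrix minus adjacency matrix, with real entries), and let H be a diagonal real matrix with nonnegative diagonal entries h_v ≥ 0. Assume that every connected component of G contains at least one vertex w with h_w > 0. Then the symmetric matrix M := L + H is positive definite, i.e., xᵀ M x > 0 for every nonzero real vector x indexed by V. -/
/-- Lemma 5 (abstract form): if `L` is the Laplacian of a finite simple graph
`G` and `H = diag(h)` with `h ≥ 0` entrywise, and every connected component of
`G` contains a vertex `w` with `h w > 0`, then `M = L + H` is positive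
definite. -/
theorem lapMatrix_add_diagonal_posDef {V : Type*} [Fintype V] [DecidableEq V]
    (G : SimpleGraph V) [DecidableRel G.Adj] (h : V → ℝ)
    (hnonneg : ∀ v, 0 ≤ h v)
    (hcomp : ∀ c : G.ConnectedComponent, ∃ w : V,
      G.connectedComponentMk w = c ∧ 0 < h w) :
    (G.lapMatrix ℝ + Matrix.diagonal h).PosDef := by
  have hL := G.posSemidef_lapMatrix ℝ
  have hH : (Matrix.diagonal h).PosSemidef := Matrix.PosSemidef.diagonal hnonneg
  refine .of_dotProduct_mulVec_pos (hL.1.add hH.1) fun x hx => ?_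
  have hL0 := hL.dotProduct_mulVec_nonneg x
  have hH0 := hH.dotProduct_mulVec_nonneg x
  rw [Matrix.add_mulVec, dotProduct_add]
  refine (add_nonneg hL0 hH0).lt_of_ne' fun hsum => hx ?_
  obtain ⟨hLx, hHx⟩ := (add_eq_zero_iff_of_nonneg hL0 hH0).1 hsum
  rw [star_trivial, ← Matrix.toLinearMap₂'_apply',
    G.lapMatrix_toLinearMap₂'_apply'_eq_zero_iff_forall_reachable] at hLx
  rw [hH.dotProduct_mulVec_zero_iff] at hHx
  ext v
  obtain ⟨w, hw, hpos⟩ := hcomp (G.connectedComponentMk v)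
  have hhw : h w * x w = 0 := by simpa only [Matrix.mulVec_diagonal, Pi.zero_apply] using congrFun hHx w
  rw [← hLx w v (SimpleGraph.ConnectedComponent.exact hw)]
  exact (mul_eq_zero.1 hhw).resolve_left hpos.ne'
end

section
/- Let G be a connected finite simple graph, let i be a vertex, let k ≥ 2, and let N_i^k := { j | 2 ≤ d(i,j) ≤ k } be the k-hop neighborhood of i, assumed nonempty, where d is graph distance. Let L be the Laplacian matrix of the subgraph of G induced on N_i^k, and let H be the diagonal matrix indexed by N_i^k whose diagonal entry at j is the number of common neighbors of j and i in G (the cardinality of {l : l adjacent to j and l adjacent to i}). Then M := L + H is a symmetric positive definite matrix. -/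
namespace SimpleGraph

variable {V : Type*}

open scoped Matrix in
theorem posDef_lapMatrix_add_diagonal [Fintype V] [DecidableEq V] (G : SimpleGraph V)
    [DecidableRel G.Adj] {d : V → ℝ} (hd : ∀ v, 0 ≤ d v)
    (hreach : ∀ v, ∃ w, G.Reachable v w ∧ 0 < d w) :
    (G.lapMatrix ℝ + Matrix.diagonal d).PosDef := by
  have hL : (G.lapMatrix ℝ).PosSemidef := G.posSemidef_lapMatrix ℝ
  have hD : (Matrix.diagonal d).PosSemidef := Matrix.PosSemidef.diagonal hd
  refine Matrix.PosDef.of_dotProduct_mulVec_pos (hL.add hD).isHermitian fun x hx => ?_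
  refine ((hL.add hD).dotProduct_mulVec_nonneg x).lt_of_ne' fun h0 => hx ?_
  have hLx := hL.dotProduct_mulVec_nonneg x
  have hDx := hD.dotProduct_mulVec_nonneg x
  rw [Matrix.add_mulVec, dotProduct_add] at h0
  have hL0 : G.lapMatrix ℝ *ᵥ x = 0 := (hL.dotProduct_mulVec_zero_iff x).1 (by linarith)
  have hD0 : Matrix.diagonal d *ᵥ x = 0 := (hD.dotProduct_mulVec_zero_iff x).1 (by linarith)
  funext v
  obtain ⟨w, hvw, hw⟩ := hreach v
  rw [(G.lapMatrix_mulVec_eq_zero_iff_forall_reachable).1 hL0 v w hvw]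
  have := congrFun hD0 w
  rw [Matrix.mulVec_diagonal] at this
  exact (mul_eq_zero.1 this).resolve_left hw.ne'

theorem Connected.exists_adj_dist_eq_s5 {G : SimpleGraph V} (hG : G.Connected) {u v : V} {n : ℕ}
    (h : G.dist u v = n + 1) : ∃ w, G.Adj v w ∧ G.dist u w = n := by
  obtain ⟨p, hp⟩ := hG.exists_walk_length_eq_dist v u
  rw [dist_comm, h] at hp
  cases p with
  | nil => simp at hp
  | @cons _ w _ hvw q =>
    refine ⟨w, hvw, le_antisymm ?_ ?_⟩
    · rw [dist_comm]
      exact (dist_le q).trans (by simpa using hp.le)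
    · have := hG.dist_triangle (u := u) (v := w) (w := v)
      rw [dist_eq_one_iff_adj.2 hvw.symm] at this
      omega

theorem Connected.exists_reachable_induce_dist_eq_two {G : SimpleGraph V} (hG : G.Connected)
    {i : V} {k : ℕ} (j : {v : V | 2 ≤ G.dist i v ∧ G.dist i v ≤ k}) :
    ∃ w : {v : V | 2 ≤ G.dist i v ∧ G.dist i v ≤ k},
      (G.induce {v : V | 2 ≤ G.dist i v ∧ G.dist i v ≤ k}).Reachable j w ∧ G.dist i w = 2 := by
  obtain ⟨j, hj⟩ := j
  obtain ⟨n, hn⟩ := Nat.exists_eq_add_of_le' hj.1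
  induction n generalizing j with
  | zero => exact ⟨⟨j, hj⟩, Reachable.refl _, by simpa using hn⟩
  | succ n ih =>
    obtain ⟨u, hju, hu⟩ := hG.exists_adj_dist_eq_s5 (n := n + 2) (by omega)
    obtain ⟨hj₁, hj₂⟩ := id hj
    obtain ⟨w, huw, hw⟩ := ih u ⟨by omega, by omega⟩ hu
    refine ⟨w, Reachable.trans (Adj.reachable ?_) huw, hw⟩
    exact hju

end SimpleGraph


/-- Lemma 5: let `G` be a connected finite simple graph, `i` a vertex,
`k ≥ 2`, and `S = N_i^k = {v | 2 ≤ d(i,v) ≤ k}` nonempty. Let `L` be the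
Laplacian of the subgraph induced on `S`, and `H` the diagonal matrix whose
entry at `j ∈ S` is the number of common neighbors of `j` and `i` in `G`.
Then `M = L + H` is symmetric positive definite. -/
theorem khop_M_matrix_posDef {V : Type*} [Fintype V] [DecidableEq V]
    (G : SimpleGraph V) [DecidableRel G.Adj] (hG : G.Connected)
    (i : V) (k : ℕ) (hk : 2 ≤ k)
    (S : Set V) (hS : S = {v : V | 2 ≤ G.dist i v ∧ G.dist i v ≤ k})
    [Fintype S] [DecidableRel (G.induce S).Adj]
    (hne : S.Nonempty) :
    ((G.induce S).lapMatrix ℝ +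
      Matrix.diagonal (fun j : S =>
        (Fintype.card {l : V // G.Adj (j : V) l ∧ G.Adj i l} : ℝ))).PosDef := by
  subst hS
  refine SimpleGraph.posDef_lapMatrix_add_diagonal _ (fun _ => Nat.cast_nonneg _) fun j => ?_
  obtain ⟨w, hjw, hw⟩ := hG.exists_reachable_induce_dist_eq_two j
  refine ⟨w, hjw, Nat.cast_pos.2 (Fintype.card_pos_iff.2 ?_)⟩
  obtain ⟨l, hwl, hl⟩ := hG.exists_adj_dist_eq_s5 hw
  exact ⟨⟨l, hwl, SimpleGraph.dist_eq_one_iff_adj.1 hl⟩⟩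
end

section
/- Let M be an n×n real symmetric positive definite matrix and let λ > 0 be a lower bound on its spectrum, in the sense that xᵀ M x ≥ λ ‖x‖² for every x ∈ ℝⁿ (with ‖·‖ the Euclidean norm). Let δ_1, …, δ_n > 0 and ρ_1, …, ρ_n > 0 be real numbers. If ‖(ρ_1, …, ρ_n)‖ ≤ λ · min_{j} δ_j, then for every index j it holds that Σ_{r=1}^n |(M⁻¹)_{j,r}| · ρ_r ≤ δ_j. (That is, the set of vectors ρ with positive entries satisfying the norm constraint ‖ρ‖ ≤ λ_min(M)·min_j δ_j is contained in the set of those satisfying the component-wise constraints Σ_r |(M⁻¹)_{j,r}| ρ_r ≤ δ_j for all j.) -/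
open Matrix

/-- If `xᵀMx ≥ λ‖x‖²` for all `x`, then every row `r` of `M⁻¹` satisfies `λ‖r‖ ≤ 1`. -/
theorem Matrix.mul_sqrt_sum_sq_inv_row_le_one {ι : Type*} [Fintype ι] [DecidableEq ι]
    {M : Matrix ι ι ℝ} (hM : IsUnit M.det) {lam : ℝ}
    (hspec : ∀ x : ι → ℝ, lam * (∑ i, x i ^ 2) ≤ x ⬝ᵥ (M *ᵥ x)) (j : ι) :
    lam * Real.sqrt (∑ r, M⁻¹ j r ^ 2) ≤ 1 := by
  have hrow : M⁻¹ j ᵥ* M = Pi.single j 1 := by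
    rw [← show Pi.single j 1 ᵥ* M⁻¹ = M⁻¹ j from Matrix.single_one_vecMul j M⁻¹,
      Matrix.vecMul_vecMul, Matrix.nonsing_inv_mul M hM, Matrix.vecMul_one]
  have hquad := hspec (M⁻¹ j)
  rw [Matrix.dotProduct_mulVec, hrow, single_one_dotProduct] at hquad
  have hentry : M⁻¹ j j ^ 2 ≤ ∑ r, M⁻¹ j r ^ 2 :=
    Finset.single_le_sum (f := fun r => M⁻¹ j r ^ 2) (fun r _ => sq_nonneg _) (Finset.mem_univ j)
  have hnonneg : 0 ≤ ∑ r, M⁻¹ j r ^ 2 := Finset.sum_nonneg fun r _ => sq_nonneg _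
  have hle := Real.le_sqrt_of_sq_le hentry
  rcases (Real.sqrt_nonneg (∑ r, M⁻¹ j r ^ 2)).eq_or_lt with h0 | hpos
  · simp [← h0]
  · refine le_of_mul_le_mul_right ?_ hpos
    rw [mul_assoc, Real.mul_self_sqrt hnonneg]
    linarith

/-- The norm-constraint design is more conservative than the component-wise
one: if `M` is symmetric positive definite with `xᵀMx ≥ λ‖x‖²`, the `δ_j, ρ_j`
are positive, and `‖ρ‖ ≤ λ · min_j δ_j`, then for every `j`,
`Σ_r |(M⁻¹)_{j,r}| ρ_r ≤ δ_j`. -/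
theorem norm_constraint_subset_componentwise (n : ℕ) (hn : 1 ≤ n)
    (M : Matrix (Fin n) (Fin n) ℝ) (hM : M.PosDef) (lam : ℝ) (hlam : 0 < lam)
    (hspec : ∀ x : Fin n → ℝ, lam * (∑ i, x i ^ 2) ≤ x ⬝ᵥ (M *ᵥ x))
    (δ ρ : Fin n → ℝ) (hδ : ∀ j, 0 < δ j) (hρ : ∀ j, 0 < ρ j)
    (hnorm : Real.sqrt (∑ i, ρ i ^ 2) ≤
      lam * Finset.univ.inf' ⟨⟨0, hn⟩, Finset.mem_univ _⟩ δ) :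
    ∀ j, ∑ r, |M⁻¹ j r| * ρ r ≤ δ j := by
  intro j
  have hM_det : IsUnit M.det := (Matrix.isUnit_iff_isUnit_det M).mp hM.isUnit
  have hrow := Matrix.mul_sqrt_sum_sq_inv_row_le_one hM_det hspec j
  have hmin := Finset.inf'_le δ (Finset.mem_univ j)
  calc ∑ r, |M⁻¹ j r| * ρ r
      ≤ Real.sqrt (∑ r, |M⁻¹ j r| ^ 2) * Real.sqrt (∑ r, ρ r ^ 2) :=
        Real.sum_mul_le_sqrt_mul_sqrt _ _ _
    _ = Real.sqrt (∑ r, M⁻¹ j r ^ 2) * Real.sqrt (∑ r, ρ r ^ 2) := by simp only [sq_abs]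
    _ ≤ Real.sqrt (∑ r, M⁻¹ j r ^ 2) * (lam * δ j) := by
        gcongr
        exact hnorm.trans (by gcongr)
    _ = lam * Real.sqrt (∑ r, M⁻¹ j r ^ 2) * δ j := by ring
    _ ≤ δ j := mul_le_of_le_one_left (hδ j).le hrow
end

section
/- (Prescribed performance state observer invariance.) Let η ≥ 1, let M be an η×η real symmetric positive definite matrix, and for each j ∈ {1,…,η} let ρ_j : ℝ → ℝ be a prescribed performance function. Let y : ℝ → ℝ be differentiable with |y'(t)| ≤ c for all t ≥ 0 for some finite constant c, and let x̂ : ℝ → ℝ^η be differentiable. Define the disagreement vector ξ(t) := M·(x̂(t) − y(t)·𝟙), where 𝟙 ∈ ℝ^η is the all-ones vector, and e_j(t) := ξ_j(t)/ρ_j(t). Assume: (a) the initialization |ξ_j(0)| < ρ_j(0) holds for every j; and (b) at every time t ≥ 0 at which |ξ_l(t)| < ρ_l(t) holds for every l, the observer dynamics hold: for every j, x̂_j'(t) = −ρ_j(t)⁻¹ · (2/(1 − e_j(t)²)) · ln((1 + e_j(t))/(1 − e_j(t))). Then for all t ≥ 0 and all j, |ξ_j(t)| < ρ_j(t); consequently,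 for all t ≥ 0 and all j, the estimation error satisfies |x̂_j(t) − y(t)| < Σ_{r=1}^η |(M⁻¹)_{j,r}| · ρ_r(t). -/
open Matrix

/-- A prescribed performance function with explicit upper bound `B` and
derivative bound `D`. -/
def IsPPFWith (ρ : ℝ → ℝ) (B D : ℝ) : Prop :=
  ContDiffOn ℝ 1 ρ (Set.Ici 0) ∧
  (∀ t ∈ Set.Ici (0 : ℝ), 0 < ρ t ∧ ρ t ≤ B) ∧
  (∀ t ∈ Set.Ici (0 : ℝ), |derivWithin ρ (Set.Ici 0) t| ≤ D)

/-- A concave quadratic form with a bounded linear perturbation is bounded above. -/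
lemma Matrix.PosDef.exists_neg_quadratic_sub_linear_le {n : Type*} [Fintype n] [DecidableEq n]
    {M : Matrix n n ℝ} (hM : M.PosDef) (W : n → ℝ) :
    ∃ C : ℝ, ∀ z w : n → ℝ, (∀ i, |w i| ≤ W i) → -(z ⬝ᵥ M *ᵥ z) - z ⬝ᵥ w ≤ C := by
  refine ⟨4⁻¹ * ∑ i, W i * ∑ j, |M⁻¹ i j| * W j, fun z w hw => ?_⟩
  have hdet : IsUnit M.det := (Matrix.isUnit_iff_isUnit_det M).1 hM.isUnit
  have hsymm : Mᵀ = M := by simpa using hM.isHermitian.eq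
  set v := M⁻¹ *ᵥ w with hv
  have hMv : M *ᵥ v = w := by
    rw [hv, mulVec_mulVec, mul_nonsing_inv M hdet, one_mulVec]
  have hvz : v ⬝ᵥ M *ᵥ z = z ⬝ᵥ w := by
    rw [dotProduct_mulVec, ← mulVec_transpose, hsymm, hMv, dotProduct_comm]
  have hnonneg : 0 ≤ (z + (2⁻¹ : ℝ) • v) ⬝ᵥ M *ᵥ (z + (2⁻¹ : ℝ) • v) := by
    simpa using hM.posSemidef.dotProduct_mulVec_nonneg (z + (2⁻¹ : ℝ) • v)
  simp only [mulVec_add, mulVec_smul, hMv, add_dotProduct, dotProduct_add, smul_dotProduct,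
    dotProduct_smul, smul_eq_mul, hvz] at hnonneg
  have hbound : v ⬝ᵥ w ≤ ∑ i, W i * ∑ j, |M⁻¹ i j| * W j := by
    rw [dotProduct_comm]
    refine Finset.sum_le_sum fun i _ => (le_abs_self _).trans ?_
    rw [abs_mul]
    refine mul_le_mul (hw i) ?_ (abs_nonneg _) ((abs_nonneg _).trans (hw i))
    refine (Finset.abs_sum_le_sum_abs _ _).trans (Finset.sum_le_sum fun j _ => ?_)
    rw [abs_mul]
    exact mul_le_mul_of_nonneg_left (hw j) (abs_nonneg _)
  linarith

/-- A componentwise strict bound on `M *ᵥ x` yields a strict bound on `x`. -/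
lemma Matrix.abs_lt_sum_abs_inv_mul {n : Type*} [Fintype n] [DecidableEq n]
    {M : Matrix n n ℝ} (hdet : IsUnit M.det) {x r : n → ℝ}
    (h : ∀ i, |(M *ᵥ x) i| < r i) (j : n) : |x j| < ∑ i, |M⁻¹ j i| * r i := by
  have hx : x j = ∑ i, M⁻¹ j i * (M *ᵥ x) i := by
    change x j = (M⁻¹ *ᵥ (M *ᵥ x)) j
    rw [mulVec_mulVec, nonsing_inv_mul M hdet, one_mulVec]
  obtain ⟨k, hk⟩ : ∃ k, M⁻¹ j k ≠ 0 := by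
    by_contra! h0
    have h1 : (M⁻¹ * M) j j = 1 := by rw [nonsing_inv_mul M hdet, one_apply_eq]
    simp [mul_apply, h0] at h1
  rw [hx]
  refine (Finset.abs_sum_le_sum_abs _ _).trans_lt (Finset.sum_lt_sum (fun i _ => ?_)
    ⟨k, Finset.mem_univ k, ?_⟩) <;> rw [abs_mul]
  · exact mul_le_mul_of_nonneg_left (h i).le (abs_nonneg _)
  · exact mul_lt_mul_of_pos_left (h k) (abs_pos.2 hk)

/-- Derivative of half the squared transformed error, with the logarithm of the quotient split. -/
lemma hasDerivAt_half_sq_log_sub_log {r x : ℝ → ℝ} {r' x' t : ℝ} (hr : HasDerivAt r r' t)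
    (hx : HasDerivAt x x' t) (h : |x t| < r t) :
    HasDerivAt (fun s => 2⁻¹ * (Real.log (r s + x s) - Real.log (r s - x s)) ^ 2)
      (((r t)⁻¹ * (2 / (1 - (x t / r t) ^ 2)) *
        Real.log ((1 + x t / r t) / (1 - x t / r t))) * (x' - x t / r t * r')) t := by
  obtain ⟨h1, h2⟩ := abs_lt.1 h
  have hr0 : 0 < r t := (abs_nonneg _).trans_lt h
  have hp : 0 < r t + x t := by linarith
  have hm : 0 < r t - x t := by linarith
  have hlog : Real.log ((1 + x t / r t) / (1 - x t / r t)) =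
      Real.log (r t + x t) - Real.log (r t - x t) := by
    rw [← Real.log_div hp.ne' hm.ne']
    congr 1
    have : 1 - x t / r t ≠ 0 := by
      rw [one_sub_div hr0.ne']; positivity
    field_simp
  have key := ((((hr.add hx).log hp.ne').sub ((hr.sub hx).log hm.ne')).pow 2).const_mul (2⁻¹ : ℝ)
  refine key.congr_deriv ?_
  have hsq : 1 - (x t / r t) ^ 2 = (r t + x t) * (r t - x t) / r t ^ 2 := by
    field_simp
    ring
  rw [hlog, hsq]
  simp only [Pi.add_apply, Pi.sub_apply]
  field_simp
  ring

/-- A bound on the transformed error keeps the error away from the funnel boundary. -/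
lemma le_exp_mul_of_half_sq_log_le {p m K : ℝ} (hp : 0 < p) (hm : 0 < m)
    (h : 2⁻¹ * (Real.log p - Real.log m) ^ 2 ≤ K) :
    p ≤ Real.exp √(2 * K) * m ∧ m ≤ Real.exp √(2 * K) * p := by
  have habs := abs_le.1 (Real.abs_le_sqrt (show (Real.log p - Real.log m) ^ 2 ≤ 2 * K by linarith))
  constructor
  · rw [← Real.log_le_log_iff hp (by positivity), Real.log_mul (Real.exp_ne_zero _) hm.ne',
      Real.log_exp]
    linarith
  · rw [← Real.log_le_log_iff hm (by positivity), Real.log_mul (Real.exp_ne_zero _) hp.ne',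
      Real.log_exp]
    linarith

/-- If finitely many funnels hold initially, and holding on `[0, T)` always forces them to hold
at `T`, then they hold for all time. -/
lemma forall_abs_lt_of_forall_abs_lt_before {ι : Type*} [Finite ι] {r x : ι → ℝ → ℝ}
    (hr : ∀ i, ContinuousOn (r i) (Set.Ici 0)) (hx : ∀ i, ContinuousOn (x i) (Set.Ici 0))
    (h0 : ∀ i, |x i 0| < r i 0)
    (hstep : ∀ T : ℝ, 0 < T → (∀ t ∈ Set.Ico 0 T, ∀ i, |x i t| < r i t) → ∀ i, |x i T| < r i T)
    {t : ℝ} (ht : 0 ≤ t) (i : ι) : |x i t| < r i t := by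
  by_contra hcon
  set S : Set ℝ := ⋃ i, {s ∈ Set.Icc 0 t | r i s ≤ |x i s|}
  have hclosed : IsClosed S := isClosed_iUnion_of_finite fun i =>
    isClosed_Icc.isClosed_le ((hr i).mono Set.Icc_subset_Ici_self)
      ((hx i).mono Set.Icc_subset_Ici_self).abs
  have hsub : S ⊆ Set.Icc 0 t := Set.iUnion_subset fun i s hs => hs.1
  have hne : S.Nonempty := ⟨t, Set.mem_iUnion.2 ⟨i, ⟨ht, le_rfl⟩, not_lt.1 hcon⟩⟩
  obtain ⟨T, hTS, hTmin⟩ := (isCompact_Icc.of_isClosed_subset hclosed hsub).exists_isLeast hne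
  obtain ⟨k, hTk, hk⟩ := Set.mem_iUnion.1 hTS
  have hT0 : 0 < T := hTk.1.lt_of_ne fun h => (h0 k).not_ge (h ▸ hk)
  refine (hstep T hT0 (fun s hs l => ?_) k).not_ge hk
  by_contra hl
  exact (hTmin (Set.mem_iUnion.2 ⟨l, ⟨hs.1, hs.2.le.trans hTk.2⟩, not_lt.1 hl⟩)).not_gt hs.2

/-- Theorem 1 (prescribed performance state observer invariance), abstract
scalar form: with disagreement `ξ(t) = M (x̂(t) − y(t) 𝟙)`, normalized
disagreement `e_j = ξ_j / ρ_j`, initialization `|ξ_j(0)| < ρ_j(0)`, and the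
observer dynamics `x̂_j' = −ρ_j⁻¹ · (2/(1−e_j²)) · ln((1+e_j)/(1−e_j))`
holding whenever all disagreements are inside their funnels, the funnels
`|ξ_j(t)| < ρ_j(t)` are forward invariant, and consequently the estimation
errors satisfy `|x̂_j(t) − y(t)| < Σ_r |(M⁻¹)_{j,r}| ρ_r(t)`. -/
theorem khop_PPSO_invariance (η : ℕ) (hη : 1 ≤ η)
    (M : Matrix (Fin η) (Fin η) ℝ) (hM : M.PosDef)
    (ρ : Fin η → ℝ → ℝ) (B D : Fin η → ℝ)
    (hρ : ∀ j, IsPPFWith (ρ j) (B j) (D j))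
    (y : ℝ → ℝ) (hy : Differentiable ℝ y)
    (c : ℝ) (hc : ∀ t : ℝ, 0 ≤ t → |deriv y t| ≤ c)
    (xhat : ℝ → Fin η → ℝ) (hxhat : ∀ j, Differentiable ℝ fun t => xhat t j)
    (ξ : ℝ → Fin η → ℝ)
    (hξ : ∀ t, ξ t = M *ᵥ (fun j => xhat t j - y t))
    (e : ℝ → Fin η → ℝ) (he : ∀ t j, e t j = ξ t j / ρ j t)
    (hinit : ∀ j, |ξ 0 j| < ρ j 0)
    (hdyn : ∀ t : ℝ, 0 ≤ t → (∀ l, |ξ t l| < ρ l t) → ∀ j,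
      deriv (fun s => xhat s j) t =
        -(ρ j t)⁻¹ * (2 / (1 - (e t j) ^ 2)) *
          Real.log ((1 + e t j) / (1 - e t j))) :
    (∀ t : ℝ, 0 ≤ t → ∀ j, |ξ t j| < ρ j t) ∧
    (∀ t : ℝ, 0 ≤ t → ∀ j, |xhat t j - y t| < ∑ r, |M⁻¹ j r| * ρ r t) := by
  have hξ' : ∀ t j, ξ t j = ∑ l, M j l * (xhat t l - y t) := fun t j => by rw [hξ]; rfl
  have hξdiff : ∀ j, Differentiable ℝ fun t => ξ t j := fun j => by
    simp only [hξ']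
    exact Differentiable.fun_sum fun l _ => ((hxhat l).sub hy).const_mul _
  have hρcont : ∀ j, ContinuousOn (ρ j) (Set.Ici 0) := fun j => (hρ j).1.continuousOn
  have hξcont : ∀ j, ContinuousOn (fun t => ξ t j) (Set.Ici 0) :=
    fun j => (hξdiff j).continuous.continuousOn
  have hρderiv : ∀ j, ∀ t : ℝ, 0 < t → ∃ d, HasDerivAt (ρ j) d t ∧ |d| ≤ D j := by
    intro j t ht
    have hd := (((hρ j).1.differentiableOn one_ne_zero) t ht.le).hasDerivWithinAt
    exact ⟨_, hd.hasDerivAt (Ici_mem_nhds ht), (hρ j).2.2 t ht.le⟩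
  have hfunnel : ∀ t : ℝ, 0 ≤ t → ∀ j, |ξ t j| < ρ j t := by
    intro t ht j
    refine forall_abs_lt_of_forall_abs_lt_before (x := fun j t => ξ t j) hρcont hξcont hinit
      (fun T hT hin => ?_) ht j
    obtain ⟨C, hC⟩ := hM.exists_neg_quadratic_sub_linear_le
      (fun i => c * |∑ l, M i l| + D i)
    set V : Fin η → ℝ → ℝ := fun j s =>
      2⁻¹ * (Real.log (ρ j s + ξ s j) - Real.log (ρ j s - ξ s j)) ^ 2
    have hVcont : ContinuousOn (fun s => ∑ j, V j s) (Set.Ico 0 T) := by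
      refine continuousOn_finsetSum _ fun j _ => ?_
      have h1 := (hρcont j).mono (Set.Ico_subset_Ici_self : Set.Ico 0 T ⊆ _)
      have h2 := (hξcont j).mono (Set.Ico_subset_Ici_self : Set.Ico 0 T ⊆ _)
      refine continuousOn_const.mul (((ContinuousOn.log (h1.add h2) fun s hs => ?_).sub
        (ContinuousOn.log (h1.sub h2) fun s hs => ?_)).pow 2)
      · exact ne_of_gt (show 0 < ρ j s + ξ s j by linarith [(abs_lt.1 (hin s hs j)).1])
      · exact ne_of_gt (show 0 < ρ j s - ξ s j by linarith [(abs_lt.1 (hin s hs j)).2])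
    have hVderiv : ∀ s ∈ Set.Ioo 0 T, ∃ v, HasDerivAt (fun s => ∑ j, V j s) v s ∧ v ≤ C := by
      intro s hs
      have hs0 : 0 ≤ s := hs.1.le
      have hins := hin s ⟨hs0, hs.2⟩
      choose d hd hdD using fun j => hρderiv j s hs.1
      set z : Fin η → ℝ := fun j => (ρ j s)⁻¹ * (2 / (1 - (ξ s j / ρ j s) ^ 2)) *
        Real.log ((1 + ξ s j / ρ j s) / (1 - ξ s j / ρ j s))
      have hxd : ∀ j, HasDerivAt (fun s => xhat s j) (-z j) s := by
        intro j
        refine (hxhat j s).hasDerivAt.congr_deriv ?_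
        rw [hdyn s hs0 hins j, he]
        ring
      have hξd : ∀ j, HasDerivAt (fun s => ξ s j) (∑ l, M j l * (-z l - deriv y s)) s := by
        intro j
        simp only [hξ']
        exact HasDerivAt.fun_sum fun l _ => ((hxd l).sub (hy s).hasDerivAt).const_mul _
      refine ⟨_, HasDerivAt.fun_sum fun j _ =>
        hasDerivAt_half_sq_log_sub_log (hd j) (hξd j) (hins j), ?_⟩
      refine le_trans (le_of_eq ?_)
        (hC z (fun i => deriv y s * ∑ l, M i l + ξ s i / ρ i s * d i) fun i => ?_)
      · simp only [dotProduct, mulVec, ← Finset.sum_neg_distrib, ← Finset.sum_sub_distrib]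
        refine Finset.sum_congr rfl fun j _ => ?_
        have hsplit : ∑ l, M j l * (-z l - deriv y s) =
            -∑ l, M j l * z l - deriv y s * ∑ l, M j l := by
          rw [Finset.mul_sum, ← Finset.sum_neg_distrib, ← Finset.sum_sub_distrib]
          exact Finset.sum_congr rfl fun l _ => by ring
        rw [hsplit]
        change z j * _ = _
        ring
      · refine (abs_add_le _ _).trans (add_le_add ?_ ?_)
        · rw [abs_mul]
          exact mul_le_mul_of_nonneg_right (hc s hs0) (abs_nonneg _)
        · have hpos : 0 < ρ i s := (abs_nonneg _).trans_lt (hins i)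
          have hle : |ξ s i / ρ i s| ≤ 1 := by
            rw [abs_div, abs_of_pos hpos, div_le_one hpos]
            exact (hins i).le
          rw [abs_mul]
          exact (mul_le_of_le_one_left (abs_nonneg _) hle).trans (hdD i)
    have hVbound : ∀ s ∈ Set.Ico 0 T, ∑ j, V j s ≤ ∑ j, V j 0 + |C| * T := by
      intro s hs
      have hmvt := (convex_Ico (0 : ℝ) T).image_sub_le_mul_sub_of_deriv_le hVcont
        (fun u hu => by
          rw [interior_Ico] at hu
          obtain ⟨v, hv, -⟩ := hVderiv u hu
          exact hv.differentiableAt.differentiableWithinAt)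
        (C := |C|)
        (fun u hu => by
          rw [interior_Ico] at hu
          obtain ⟨v, hv, hvC⟩ := hVderiv u hu
          exact hv.deriv ▸ hvC.trans (le_abs_self C))
        0 ⟨le_rfl, hT⟩ s hs hs.1
      have := mul_le_mul_of_nonneg_left hs.2.le (abs_nonneg C)
      simp only [sub_zero] at hmvt
      linarith
    set E := Real.exp √(2 * (∑ j, V j 0 + |C| * T))
    intro i
    have hsep : ∀ s ∈ Set.Ico 0 T,
        ρ i s + ξ s i ≤ E * (ρ i s - ξ s i) ∧ ρ i s - ξ s i ≤ E * (ρ i s + ξ s i) := by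
      intro s hs
      have hle : V i s ≤ ∑ j, V j 0 + |C| * T :=
        (Finset.single_le_sum (f := fun j => V j s) (fun j _ => by positivity)
          (Finset.mem_univ i)).trans (hVbound s hs)
      obtain ⟨h1, h2⟩ := abs_lt.1 (hin s hs i)
      exact le_exp_mul_of_half_sq_log_le (by linarith) (by linarith) hle
    have hTcl : T ∈ closure (Set.Ico 0 T) := by
      rw [closure_Ico hT.ne]
      exact ⟨hT.le, le_rfl⟩
    have hclsub : closure (Set.Ico 0 T) ⊆ Set.Ici 0 := by
      rw [closure_Ico hT.ne]
      exact Set.Icc_subset_Ici_self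
    have hρcl := (hρcont i).mono hclsub
    have hξcl := (hξcont i).mono hclsub
    have hup := le_on_closure (fun s hs => (hsep s hs).1) (hρcl.add hξcl)
      (continuousOn_const.mul (hρcl.sub hξcl)) hTcl
    have hlow := le_on_closure (fun s hs => (hsep s hs).2) (hρcl.sub hξcl)
      (continuousOn_const.mul (hρcl.add hξcl)) hTcl
    have hρT : 0 < ρ i T := ((hρ i).2.1 T hT.le).1
    have hE0 : 0 < E := Real.exp_pos _
    rw [abs_lt]
    constructor <;> nlinarith
  refine ⟨hfunnel, fun t ht j => ?_⟩
  refine abs_lt_sum_abs_inv_mul (x := fun j => xhat t j - y t)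
    ((Matrix.isUnit_iff_isUnit_det M).1 hM.isUnit) (fun i => ?_) j
  rw [← hξ]
  exact hfunnel t ht i
end
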